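/- Let μ be a finite positive Borel measure on the unit circle ∂𝔻 and let n be a nonnegative integer. An analytic function f on 𝔻 belongs to the Dirichlet-type space D(μ), i.e. ∫_𝔻 |f'(z)|² P_μ(z) dA(z) < ∞, if and only if ∫_𝔻 |f^{(n+1)}(z)|² (1−|z|²)^{2n} P_μ(z) dA(z) < ∞. -/

import Mathlib

open MeasureTheory

noncomputable section

/-- The Poisson integral `P_μ(z) = (1/2π) ∫_{∂𝔻} (1-|z|²)/|ζ-z|² dμ(ζ)` of a measure `μ`
on the unit circle. -/
def poissonInt (μ : Measure ℂ) (z : ℂ) : ℝ :=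
  (2 * Real.pi)⁻¹ * ∫ ζ, (1 - ‖z‖ ^ 2) / ‖ζ - z‖ ^ 2 ∂μ

open ComplexConjugate

theorem hasDerivAt_max_zero_pow (j : ℕ) (hj : 1 ≤ j) (s : ℝ) :
    HasDerivAt (fun t : ℝ => max t 0 ^ (j + 1)) ((j + 1) * max s 0 ^ j) s := by
  rcases lt_trichotomy s 0 with hs | rfl | hs
  · have h0 : (fun t : ℝ => max t 0 ^ (j + 1)) =ᶠ[nhds s] fun _ => 0 := by
      filter_upwards [Iio_mem_nhds hs] with t ht
      simp [max_eq_right (Set.mem_Iio.1 ht).le]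
    rw [max_eq_right hs.le, zero_pow (by omega), mul_zero]
    exact (hasDerivAt_const s (0 : ℝ)).congr_of_eventuallyEq h0
  · rw [max_self, zero_pow (by omega), mul_zero]
    have hO : (fun t : ℝ => max t 0 ^ (j + 1)) =O[nhds 0] fun t : ℝ => t ^ (j + 1) := by
      refine Asymptotics.IsBigO.of_bound 1 (Filter.Eventually.of_forall fun t => ?_)
      rw [one_mul, norm_pow, norm_pow]
      gcongr
      rw [Real.norm_eq_abs, Real.norm_eq_abs, abs_of_nonneg (le_max_right _ _)]
      exact max_le (le_abs_self t) (abs_nonneg t)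
    have ho : (fun t : ℝ => t ^ (j + 1)) =o[nhds 0] fun t : ℝ => t := by
      simpa using Asymptotics.isLittleO_pow_pow (𝕜 := ℝ) (m := 1) (n := j + 1) (by omega)
    rw [hasDerivAt_iff_isLittleO]
    simpa using hO.trans_isLittleO ho
  · have h0 : (fun t : ℝ => max t 0 ^ (j + 1)) =ᶠ[nhds s] fun t => t ^ (j + 1) := by
      filter_upwards [Ioi_mem_nhds hs] with t ht
      rw [max_eq_left (le_of_lt ht)]
    rw [max_eq_left hs.le]
    simpa using (hasDerivAt_pow (j + 1) s).congr_of_eventuallyEq h0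


theorem integral_lineDeriv_eq_zero {H H' : ℂ → ℂ} {v : ℂ} (hH : Integrable H)
    (hH' : Integrable H') (h : ∀ z, HasLineDerivAt ℝ H (H' z) z v) : ∫ z, H' z = 0 := by
  have := integral_bilinear_hasLineDerivAt_right_eq_neg_left_of_integrable (μ := volume)
    (f := fun _ : ℂ => (1 : ℝ)) (f' := fun _ => 0) (g := H) (g' := H') (v := v)
    (B := ContinuousLinearMap.lsmul ℝ ℝ) (by simp) (by simpa using hH') (by simpa using hH)
    (fun x _ => hasDerivAt_const (0 : ℝ) (1 : ℝ)) (fun x _ => h x)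
  simpa using this

theorem hasLineDerivAt_mul_conj_mul_max_pow {p q : ℂ → ℂ} {z : ℂ} (hp : DifferentiableAt ℂ p z)
    (hq : DifferentiableAt ℂ q z) (r : ℝ) {j : ℕ} (hj : 1 ≤ j) (v : ℂ) :
    HasLineDerivAt ℝ (fun z => p z * conj (q z) * ((max (r ^ 2 - ‖z‖ ^ 2) 0 ^ (j + 1) : ℝ) : ℂ))
      ((deriv p z * v * conj (q z) + p z * conj (deriv q z * v)) *
          ((max (r ^ 2 - ‖z‖ ^ 2) 0 ^ (j + 1) : ℝ) : ℂ) +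
        p z * conj (q z) * (((j + 1) * max (r ^ 2 - ‖z‖ ^ 2) 0 ^ j *
          (-2 * (z.re * v.re + z.im * v.im)) : ℝ) : ℂ)) z v := by
  unfold HasLineDerivAt
  have hl : HasDerivAt (fun t : ℝ => z + t • v) v 0 := by
    simpa using ((hasDerivAt_id (0 : ℝ)).smul_const v).const_add z
  have hz : z + (0 : ℝ) • v = z := by simp
  have h1 : HasDerivAt (fun t : ℝ => p (z + t • v)) (deriv p z * v) 0 := by
    refine HasDerivAt.comp (0 : ℝ) (h₂ := p) ?_ hl
    rw [hz]
    exact hp.hasDerivAt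
  have h2 : HasDerivAt (fun t : ℝ => q (z + t • v)) (deriv q z * v) 0 := by
    refine HasDerivAt.comp (0 : ℝ) (h₂ := q) ?_ hl
    rw [hz]
    exact hq.hasDerivAt
  have h3 : HasDerivAt (fun t : ℝ => conj (q (z + t • v))) (conj (deriv q z * v)) 0 := h2.star
  have h4 : HasDerivAt (fun t : ℝ => r ^ 2 - ‖z + t • v‖ ^ 2)
      (-2 * (z.re * v.re + z.im * v.im)) 0 := by
    have e : (fun t : ℝ => r ^ 2 - ‖z + t • v‖ ^ 2) =
        fun t : ℝ => r ^ 2 - ((z.re + t * v.re) ^ 2 + (z.im + t * v.im) ^ 2) := by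
      funext t
      rw [Complex.sq_norm, Complex.normSq_apply]
      simp
      ring
    rw [e]
    have ha : HasDerivAt (fun t : ℝ => z.re + t * v.re) v.re 0 := by
      simpa using ((hasDerivAt_id (0 : ℝ)).mul_const v.re).const_add z.re
    have hb : HasDerivAt (fun t : ℝ => z.im + t * v.im) v.im 0 := by
      simpa using ((hasDerivAt_id (0 : ℝ)).mul_const v.im).const_add z.im
    refine (((ha.pow 2).add (hb.pow 2)).const_sub (r ^ 2)).congr_deriv ?_
    simp
    ring
  have h5 := (hasDerivAt_max_zero_pow j hj (r ^ 2 - ‖z + (0 : ℝ) • v‖ ^ 2)).comp (0 : ℝ) h4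
  refine ((h1.mul h3).mul h5.ofReal_comp).congr_deriv ?_
  simp

theorem integral_closedBall_deriv_mul_conj_mul_pow {p q : ℂ → ℂ}
    (hp : DifferentiableOn ℂ p (Metric.ball 0 1)) (hq : DifferentiableOn ℂ q (Metric.ball 0 1))
    {r : ℝ} (hr0 : 0 < r) (hr : r < 1) {j : ℕ} (hj : 1 ≤ j) :
    ∫ z in Metric.closedBall (0 : ℂ) r,
      (deriv p z * conj (q z) * ((r ^ 2 - ‖z‖ ^ 2 : ℝ) : ℂ) ^ (j + 1)
        - (j + 1) * conj z * p z * conj (q z) * ((r ^ 2 - ‖z‖ ^ 2 : ℝ) : ℂ) ^ j) = 0 := by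
  have hsub : Metric.closedBall (0 : ℂ) r ⊆ Metric.ball 0 1 := Metric.closedBall_subset_ball hr
  have hmax : ∀ z : ℂ, z ∉ Metric.closedBall (0 : ℂ) r → max (r ^ 2 - ‖z‖ ^ 2) 0 = 0 := by
    intro z hz
    rw [Metric.mem_closedBall, dist_zero_right, not_le] at hz
    exact max_eq_right (by nlinarith)
  have hpc := hp.continuousOn.mono hsub
  have hqc := hq.continuousOn.mono hsub
  have hpc' := (hp.deriv Metric.isOpen_ball).continuousOn.mono hsub
  have hqc' := (hq.deriv Metric.isOpen_ball).continuousOn.mono hsub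
  set H : ℂ → ℂ := fun z => p z * conj (q z) * ((max (r ^ 2 - ‖z‖ ^ 2) 0 ^ (j + 1) : ℝ) : ℂ)
    with hH
  set D : ℂ → ℂ → ℂ := fun v z => (deriv p z * v * conj (q z) + p z * conj (deriv q z * v)) *
          ((max (r ^ 2 - ‖z‖ ^ 2) 0 ^ (j + 1) : ℝ) : ℂ) +
        p z * conj (q z) * (((j + 1) * max (r ^ 2 - ‖z‖ ^ 2) 0 ^ j *
          (-2 * (z.re * v.re + z.im * v.im)) : ℝ) : ℂ) with hD
  have hH0 : ∀ z : ℂ, z ∉ Metric.closedBall (0 : ℂ) r → H z = 0 := by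
    intro z hz
    simp [hH, hmax z hz]
  have hD0 : ∀ v, ∀ z : ℂ, z ∉ Metric.closedBall (0 : ℂ) r → D v z = 0 := by
    intro v z hz
    simp [hD, hmax z hz, show j ≠ 0 by omega]
  have hHi : Integrable H := by
    refine IntegrableOn.integrable_of_forall_notMem_eq_zero (s := Metric.closedBall (0 : ℂ) r)
      (ContinuousOn.integrableOn_compact (isCompact_closedBall 0 r) ?_) hH0
    fun_prop
  have hDi : ∀ v, Integrable (D v) := by
    intro v
    refine IntegrableOn.integrable_of_forall_notMem_eq_zero (s := Metric.closedBall (0 : ℂ) r)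
      (ContinuousOn.integrableOn_compact (isCompact_closedBall 0 r) ?_) (hD0 v)
    fun_prop
  have hline : ∀ v z, HasLineDerivAt ℝ H (D v z) z v := by
    intro v z
    by_cases hz : z ∈ Metric.closedBall (0 : ℂ) r
    · have hm := Metric.isOpen_ball.mem_nhds (hsub hz)
      exact hasLineDerivAt_mul_conj_mul_max_pow (hp.differentiableAt hm)
        (hq.differentiableAt hm) r hj v
    · rw [hD0 v z hz]
      have : H =ᶠ[nhds z] fun _ => 0 := by
        filter_upwards [Metric.isClosed_closedBall.isOpen_compl.mem_nhds hz] with w hw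
        exact hH0 w hw
      have h0 : HasLineDerivAt ℝ (fun _ : ℂ => (0 : ℂ)) 0 z v := hasDerivAt_const (0 : ℝ) (0 : ℂ)
      exact h0.congr_of_eventuallyEq this
  have hsum : ∫ z, (D 1 z - Complex.I * D Complex.I z) = 0 := by
    rw [integral_sub (hDi 1) ((hDi Complex.I).const_mul _), integral_const_mul,
      integral_lineDeriv_eq_zero hHi (hDi 1) (hline 1),
      integral_lineDeriv_eq_zero hHi (hDi _) (hline _)]
    simp
  rw [← setIntegral_eq_integral_of_forall_compl_eq_zero (s := Metric.closedBall (0 : ℂ) r)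
    (fun z hz => by rw [hD0 _ z hz, hD0 _ z hz]; simp)] at hsum
  have h2 : (2 : ℂ) * ∫ z in Metric.closedBall (0 : ℂ) r,
      (deriv p z * conj (q z) * ((r ^ 2 - ‖z‖ ^ 2 : ℝ) : ℂ) ^ (j + 1)
        - (j + 1) * conj z * p z * conj (q z) * ((r ^ 2 - ‖z‖ ^ 2 : ℝ) : ℂ) ^ j) = 0 := by
    rw [← integral_const_mul]
    refine Eq.trans ?_ hsum
    refine setIntegral_congr_fun Metric.isClosed_closedBall.measurableSet fun z hz => ?_
    rw [Metric.mem_closedBall, dist_zero_right] at hz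
    have hm : max (r ^ 2 - ‖z‖ ^ 2) 0 = r ^ 2 - ‖z‖ ^ 2 :=
      max_eq_left (by nlinarith [norm_nonneg z])
    have hc : conj z = z.re - Complex.I * z.im := by
      apply Complex.ext <;> simp
    simp only [hD, hm, hc]
    push_cast
    simp only [map_mul, map_one, Complex.conj_I, Complex.one_re, Complex.one_im, Complex.I_re,
      Complex.I_im]
    push_cast
    linear_combination (deriv p z * conj (q z) - p z * conj (deriv q z)) *
      ((r : ℂ) ^ 2 - (‖z‖ : ℂ) ^ 2) ^ (j + 1) * Complex.I_sq
  exact (mul_eq_zero.1 h2).resolve_left two_ne_zero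

theorem two_mul_re_one_sub_conj_mul {l : ℂ} (hl : ‖l‖ = 1) (z : ℂ) :
    2 * (1 - conj l * z).re = 1 - ‖z‖ ^ 2 + ‖1 - conj l * z‖ ^ 2 := by
  have h : ‖conj l * z‖ ^ 2 = ‖z‖ ^ 2 := by simp [hl]
  rw [← h, Complex.sq_norm, Complex.sq_norm, Complex.normSq_apply, Complex.normSq_apply]
  simp only [Complex.sub_re, Complex.sub_im, Complex.one_re, Complex.one_im]
  ring

theorem norm_one_sub_conj_mul {l : ℂ} (hl : ‖l‖ = 1) (z : ℂ) : ‖1 - conj l * z‖ = ‖l - z‖ := by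
  have h : conj l * l = 1 := by
    rw [Complex.conj_mul', hl]; simp
  rw [← h, ← mul_sub, norm_mul, RCLike.norm_conj, hl, one_mul]

theorem norm_sq_deriv_le_add_re {l z G G' : ℂ} {u : ℝ} (e : ℕ) (hl : ‖l‖ = 1) (hz : ‖z‖ < 1)
    (hu : 0 ≤ u) (hu1 : u ≤ 1 - ‖z‖ ^ 2) :
    ‖G'‖ ^ 2 * u ^ (e + 2) / ‖l - z‖ ^ 2 ≤ (e + 4) ^ 2 * (‖G‖ ^ 2 * u ^ e / ‖l - z‖ ^ 2) +
      2 * ((G' / (1 - conj l * z) + G * conj l / (1 - conj l * z) ^ 2) *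
          conj (G' / (1 - conj l * z)) * (u : ℂ) ^ (e + 1 + 1) -
        ((e + 1 : ℕ) + 1) * conj z * (G / (1 - conj l * z)) * conj (G' / (1 - conj l * z)) *
          (u : ℂ) ^ (e + 1)).re := by
  have hre := two_mul_re_one_sub_conj_mul hl z
  have hζ : 1 - conj l * z ≠ 0 := by
    intro h
    rw [h] at hre
    simp at hre
    nlinarith [norm_nonneg z]
  rw [← norm_one_sub_conj_mul hl z]
  have hll : ‖conj l‖ = 1 := by simpa using hl
  set m := conj l
  set ζ := 1 - m * z
  have hN : 0 < ‖ζ‖ := norm_pos_iff.2 hζ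
  have hζ' : conj ζ ≠ 0 := by simpa using hζ
  have hE : (G' / ζ + G * m / ζ ^ 2) * conj (G' / ζ) * (u : ℂ) ^ (e + 1 + 1) -
        ((e + 1 : ℕ) + 1) * conj z * (G / ζ) * conj (G' / ζ) * (u : ℂ) ^ (e + 1) =
      ((u ^ e / ‖ζ‖ ^ 2 : ℝ) : ℂ) * (((‖G'‖ ^ 2 * u ^ 2 : ℝ) : ℂ) +
        ((u : ℝ) : ℂ) * (G * conj G' * (m * u / ζ - (e + 2) * conj z))) := by
    push_cast
    rw [← Complex.mul_conj' ζ, ← Complex.mul_conj' G', map_div₀]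
    field_simp
    ring
  rw [hE, Complex.re_ofReal_mul, Complex.add_re, Complex.ofReal_re, Complex.re_ofReal_mul]
  have hb : ‖G * conj G' * (m * u / ζ - (e + 2) * conj z)‖ ≤ ‖G‖ * ‖G'‖ * (e + 4) := by
    rw [norm_mul, norm_mul, RCLike.norm_conj]
    gcongr
    have h1 : ‖m * u / ζ‖ ≤ 2 := by
      rw [norm_div, norm_mul, hll, one_mul, Complex.norm_real, Real.norm_of_nonneg hu,
        div_le_iff₀ hN]
      nlinarith [Complex.re_le_norm ζ]
    have h2 : ‖((e : ℂ) + 2) * conj z‖ ≤ e + 2 := by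
      rw [norm_mul, RCLike.norm_conj]
      have : ‖(e : ℂ) + 2‖ = e + 2 := by
        have := Complex.norm_natCast (e + 2)
        push_cast at this
        exact this
      rw [this]
      nlinarith [norm_nonneg z]
    linarith [norm_sub_le (m * u / ζ) ((e + 2) * conj z)]
  have hR := neg_le_of_abs_le
    (Complex.abs_re_le_norm (G * conj G' * (m * u / ζ - (e + 2) * conj z)))
  set R := (G * conj G' * (m * u / ζ - (e + 2) * conj z)).re
  have hT : 0 ≤ u ^ e / ‖ζ‖ ^ 2 := by positivity
  have e1 : ‖G'‖ ^ 2 * u ^ (e + 2) / ‖ζ‖ ^ 2 = u ^ e / ‖ζ‖ ^ 2 * (‖G'‖ ^ 2 * u ^ 2) := by ring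
  have e2 : ‖G‖ ^ 2 * u ^ e / ‖ζ‖ ^ 2 = u ^ e / ‖ζ‖ ^ 2 * ‖G‖ ^ 2 := by ring
  rw [e1, e2]
  have key : ‖G'‖ ^ 2 * u ^ 2 ≤ (e + 4) ^ 2 * ‖G‖ ^ 2 + 2 * (‖G'‖ ^ 2 * u ^ 2 + u * R) := by
    have h3 : u * R ≥ - (u * (‖G‖ * ‖G'‖ * (e + 4))) := by
      have := mul_le_mul_of_nonneg_left (hR.trans' (neg_le_neg hb)) hu
      linarith
    nlinarith [sq_nonneg (‖G'‖ * u - (e + 4) * ‖G‖)]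
  nlinarith [mul_le_mul_of_nonneg_left key hT]

theorem mul_sq_le_sub_of_weights {e x u c y T A B R M : ℝ} (he : 1 ≤ e) (hx0 : 0 ≤ x)
    (hu : 0 ≤ u) (hux : u ≤ 1 - x ^ 2) (hc0 : 0 ≤ c) (hc1 : c ≤ 1) (hy : y ≤ 2 * c)
    (hT : 0 ≤ T) (hA : 0 ≤ A) (hR : R ≤ 7 / 4 * (A * B))
    (hM : x ≤ 19 / 20 → T ≤ 400 ∧ A ≤ M) :
    T * A ^ 2 ≤ 56 * (T * (B ^ 2 * u ^ 2)) + 12800 * M ^ 2 -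
      8 * (T * (u * R - A ^ 2 * ((e + 1) * x ^ 2 * (1 + 3 / 4 * (2 * c - 1)) - y -
        3 / 4 * u * (2 * c - 1)))) := by
  have hm : 2 * x ^ 2 * (1 / 4 + 3 / 2 * c) ≤ (e + 1) * x ^ 2 * (1 + 3 / 4 * (2 * c - 1)) := by
    have : 1 + 3 / 4 * (2 * c - 1) = 1 / 4 + 3 / 2 * c := by ring
    rw [this]
    gcongr
    linarith
  have hl3 : u * (2 * c - 1) ≤ u := by nlinarith
  have hx2 : 0 ≤ x ^ 2 := by positivity
  have hxc : 0 ≤ x ^ 2 * c := by positivity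
  have huR : u * R ≤ 7 / 4 * (A * (B * u)) := by nlinarith
  have hdisc : 14 * (A * (B * u)) ≤ 56 * (B ^ 2 * u ^ 2) + A ^ 2 := by
    nlinarith [sq_nonneg (7 * (B * u) - A), sq_nonneg (B * u)]
  have hA2 : 0 ≤ A ^ 2 := by positivity
  set q := (e + 1) * x ^ 2 * (1 + 3 / 4 * (2 * c - 1)) - y - 3 / 4 * u * (2 * c - 1) with hq
  rcases le_or_gt x (19 / 20) with hs | hs
  · obtain ⟨hT4, hAM⟩ := hM hs
    have hq3 : -3 ≤ q := by linarith
    have h1 : T * A ^ 2 ≤ 400 * M ^ 2 := by gcongr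
    have h2 : 8 * (u * R - A ^ 2 * q) ≤ 56 * (B ^ 2 * u ^ 2) + 25 * A ^ 2 := by
      nlinarith [mul_le_mul_of_nonneg_left hq3 hA2]
    nlinarith [mul_le_mul_of_nonneg_left h2 hT, sq_nonneg M]
  · have hx9 : 361 / 400 ≤ x ^ 2 := by nlinarith
    have hxc9 : 361 / 400 * c ≤ x ^ 2 * c := by gcongr
    have hq4 : 1 / 4 ≤ q := by linarith
    have h2 : 8 * (u * R - A ^ 2 * q) ≤ 56 * (B ^ 2 * u ^ 2) - A ^ 2 := by
      nlinarith [mul_le_mul_of_nonneg_left hq4 hA2]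
    nlinarith [mul_le_mul_of_nonneg_left h2 hT, sq_nonneg M]

theorem norm_sq_le_sub_re {l z G G' : ℂ} {u M : ℝ} {e : ℕ} (he : 1 ≤ e) (hl : ‖l‖ = 1)
    (hz : ‖z‖ < 1) (hu : 0 ≤ u) (hu1 : u ≤ 1 - ‖z‖ ^ 2) (hM : ‖z‖ ≤ 19 / 20 → ‖G‖ ≤ M) :
    ‖G‖ ^ 2 * u ^ e / ‖l - z‖ ^ 2 ≤ 56 * (‖G'‖ ^ 2 * u ^ (e + 2) / ‖l - z‖ ^ 2) + 12800 * M ^ 2 -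
      8 * (((G / (1 - conj l * z) ^ 2 + z * G' / (1 - conj l * z)) * conj (G / (1 - conj l * z)) *
            (u : ℂ) ^ (e + 1) -
          (e + 1) * conj z * (z * G / (1 - conj l * z)) * conj (G / (1 - conj l * z)) *
            (u : ℂ) ^ e) +
        3 / 4 * ((G + z * G') * conj (G / (1 - conj l * z) ^ 2) * (u : ℂ) ^ (e + 1) -
          (e + 1) * conj z * (z * G) * conj (G / (1 - conj l * z) ^ 2) * (u : ℂ) ^ e)).re := by
  have hre := two_mul_re_one_sub_conj_mul hl z
  have hζ : 1 - conj l * z ≠ 0 := by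
    intro h
    rw [h] at hre
    simp at hre
    nlinarith [norm_nonneg z]
  have hdist : 1 - ‖z‖ ≤ ‖1 - conj l * z‖ := by
    rw [norm_one_sub_conj_mul hl, ← hl]
    exact norm_sub_norm_le l z
  rw [← norm_one_sub_conj_mul hl z]
  set ζ := 1 - conj l * z
  have hN : 0 < ‖ζ‖ := norm_pos_iff.2 hζ
  have hζ' : conj ζ ≠ 0 := by simpa using hζ
  set κ := ζ / conj ζ with hκ
  set Q : ℂ := ((((e : ℝ) + 1) * ‖z‖ ^ 2 : ℝ) : ℂ) * (1 + ((3 / 4 : ℝ) : ℂ) * κ) -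
    (u : ℂ) * ζ⁻¹ - ((3 / 4 * u : ℝ) : ℂ) * κ with hQ
  have hE : ((G / ζ ^ 2 + z * G' / ζ) * conj (G / ζ) * (u : ℂ) ^ (e + 1) -
          (e + 1) * conj z * (z * G / ζ) * conj (G / ζ) * (u : ℂ) ^ e) +
        3 / 4 * ((G + z * G') * conj (G / ζ ^ 2) * (u : ℂ) ^ (e + 1) -
          (e + 1) * conj z * (z * G) * conj (G / ζ ^ 2) * (u : ℂ) ^ e) =
      ((u ^ e / ‖ζ‖ ^ 2 : ℝ) : ℂ) * ((u : ℂ) * (z * G' * conj G * (1 + 3 / 4 * κ)) -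
        ((‖G‖ ^ 2 : ℝ) : ℂ) * Q) := by
    rw [hQ, hκ]
    push_cast
    rw [← Complex.mul_conj' ζ, ← Complex.mul_conj' G, ← Complex.mul_conj' z, map_div₀, map_div₀,
      map_pow]
    field_simp
    ring
  have hκn : ‖κ‖ = 1 := by
    rw [hκ, norm_div, RCLike.norm_conj, div_self hN.ne']
  have hsq : ‖ζ‖ ^ 2 = ζ.re ^ 2 + ζ.im ^ 2 := by
    rw [Complex.sq_norm, Complex.normSq_apply]; ring
  have hκre : κ.re = 2 * (ζ.re ^ 2 / ‖ζ‖ ^ 2) - 1 := by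
    have : κ = ζ * ζ / ((‖ζ‖ ^ 2 : ℝ) : ℂ) := by
      rw [hκ]
      push_cast
      rw [← Complex.mul_conj' ζ]
      field_simp
    rw [this, Complex.div_ofReal_re, Complex.mul_re]
    field_simp
    rw [hsq]
    ring
  have hinv : (ζ⁻¹).re = ζ.re / ‖ζ‖ ^ 2 := by
    rw [Complex.inv_re, Complex.sq_norm]
  have hc0 : 0 ≤ ζ.re ^ 2 / ‖ζ‖ ^ 2 := by positivity
  have hc1 : ζ.re ^ 2 / ‖ζ‖ ^ 2 ≤ 1 := by
    rw [div_le_one (by positivity), hsq]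
    nlinarith [sq_nonneg ζ.im]
  have hui : u * (ζ⁻¹).re ≤ 2 * (ζ.re ^ 2 / ‖ζ‖ ^ 2) := by
    rw [hinv, ← mul_div_assoc, ← mul_div_assoc]
    refine div_le_div_of_nonneg_right ?_ (by positivity)
    have : u ≤ 2 * ζ.re := by nlinarith
    nlinarith
  have hQre : Q.re = ((e : ℝ) + 1) * ‖z‖ ^ 2 * (1 + 3 / 4 * κ.re) - u * (ζ⁻¹).re -
      3 / 4 * u * κ.re := by
    rw [hQ]
    simp only [Complex.sub_re, Complex.re_ofReal_mul, Complex.add_re, Complex.one_re]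
  have hb : ‖z * G' * conj G * (1 + 3 / 4 * κ)‖ ≤ 7 / 4 * (‖G‖ * ‖G'‖) := by
    rw [norm_mul, norm_mul, norm_mul, RCLike.norm_conj]
    have h1 : ‖1 + 3 / 4 * κ‖ ≤ 7 / 4 := by
      refine (norm_add_le _ _).trans ?_
      rw [norm_mul, hκn]
      norm_num
    calc ‖z‖ * ‖G'‖ * ‖G‖ * ‖1 + 3 / 4 * κ‖ ≤ 1 * ‖G'‖ * ‖G‖ * (7 / 4) := by gcongr
      _ = _ := by ring
  have hR := (le_of_abs_le (Complex.abs_re_le_norm (z * G' * conj G * (1 + 3 / 4 * κ)))).trans hb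
  rw [hE, Complex.re_ofReal_mul, Complex.sub_re, Complex.re_ofReal_mul, Complex.re_ofReal_mul, hQre]
  generalize (z * G' * conj G * (1 + 3 / 4 * κ)).re = R at *
  rw [hκre]
  set c := ζ.re ^ 2 / ‖ζ‖ ^ 2
  set T := u ^ e / ‖ζ‖ ^ 2 with hT'
  have hT : 0 ≤ T := by positivity
  have e1 : ‖G'‖ ^ 2 * u ^ (e + 2) / ‖ζ‖ ^ 2 = T * (‖G'‖ ^ 2 * u ^ 2) := by rw [hT']; ring
  have e2 : ‖G‖ ^ 2 * u ^ e / ‖ζ‖ ^ 2 = T * ‖G‖ ^ 2 := by rw [hT']; ring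
  rw [e1, e2]
  refine mul_sq_le_sub_of_weights (by exact_mod_cast he) (norm_nonneg z) hu hu1 hc0 hc1 hui hT
    (norm_nonneg G) hR fun hs => ⟨?_, hM hs⟩
  rw [hT', div_le_iff₀ (by positivity)]
  have : u ^ e ≤ 1 := pow_le_one₀ hu (by nlinarith [norm_nonneg z])
  nlinarith

theorem sub_ne_zero_of_norm_lt {l z : ℂ} (hl : ‖l‖ = 1) (hz : ‖z‖ < 1) : l - z ≠ 0 := by
  intro h
  rw [sub_eq_zero.1 h] at hl
  linarith

theorem continuousOn_mul_pow_div {F : ℂ → ℝ} (hF : ContinuousOn F (Metric.ball 0 1)) {l : ℂ}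
    (hl : ‖l‖ = 1) {r : ℝ} (hr : r < 1) (a : ℕ) :
    ContinuousOn (fun z => F z * (r ^ 2 - ‖z‖ ^ 2) ^ a / ‖l - z‖ ^ 2)
      (Metric.closedBall 0 r) := by
  have hF' := hF.mono (Metric.closedBall_subset_ball hr)
  refine ContinuousOn.div (by fun_prop) (by fun_prop) fun z hz => ?_
  have : ‖z‖ < 1 := (mem_closedBall_zero_iff.1 hz).trans_lt hr
  exact pow_ne_zero 2 (norm_ne_zero_iff.2 (sub_ne_zero_of_norm_lt hl this))

theorem lintegral_ball_le_of_integral_closedBall_le {F₁ F₂ : ℂ → ℝ} (hF₁ : Measurable F₁)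
    (hc₁ : ContinuousOn F₁ (Metric.ball 0 1)) (hc₂ : ContinuousOn F₂ (Metric.ball 0 1))
    (h₁ : ∀ z, 0 ≤ F₁ z) (h₂ : ∀ z, 0 ≤ F₂ z) {l : ℂ} (hl : ‖l‖ = 1) {a b : ℕ} (ha : 1 ≤ a)
    {C C' : ℝ} (hC : 0 ≤ C) (hC' : 0 ≤ C')
    (H : ∀ r : ℝ, 0 < r → r < 1 →
      ∫ z in Metric.closedBall (0 : ℂ) r, F₁ z * (r ^ 2 - ‖z‖ ^ 2) ^ a / ‖l - z‖ ^ 2 ≤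
        C' + C * ∫ z in Metric.closedBall (0 : ℂ) r,
          F₂ z * (r ^ 2 - ‖z‖ ^ 2) ^ b / ‖l - z‖ ^ 2) :
    ∫⁻ z in Metric.ball (0 : ℂ) 1, ENNReal.ofReal (F₁ z * (1 - ‖z‖ ^ 2) ^ a / ‖l - z‖ ^ 2) ≤
      ENNReal.ofReal C' + ENNReal.ofReal C * ∫⁻ z in Metric.ball (0 : ℂ) 1,
        ENNReal.ofReal (F₂ z * (1 - ‖z‖ ^ 2) ^ b / ‖l - z‖ ^ 2) := by
  set B := ENNReal.ofReal C' + ENNReal.ofReal C * ∫⁻ z in Metric.ball (0 : ℂ) 1,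
        ENNReal.ofReal (F₂ z * (1 - ‖z‖ ^ 2) ^ b / ‖l - z‖ ^ 2)
  set φ : ℝ → ℂ → ENNReal := fun r z =>
    ENNReal.ofReal (F₁ z * max (r ^ 2 - ‖z‖ ^ 2) 0 ^ a / ‖l - z‖ ^ 2) with hφ
  have hbound : ∀ r : ℝ, 0 < r → r < 1 → ∫⁻ z in Metric.ball (0 : ℂ) 1, φ r z ≤ B := by
    intro r hr0 hr
    have hsub : Metric.closedBall (0 : ℂ) r ⊆ Metric.ball 0 1 := Metric.closedBall_subset_ball hr
    have hmeas : MeasurableSet (Metric.closedBall (0 : ℂ) r) :=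
      Metric.isClosed_closedBall.measurableSet
    have hpos : ∀ z ∈ Metric.closedBall (0 : ℂ) r, 0 ≤ r ^ 2 - ‖z‖ ^ 2 := by
      intro z hz
      have := mem_closedBall_zero_iff.1 hz
      nlinarith [norm_nonneg z]
    have hi₁ : IntegrableOn (fun z => F₁ z * (r ^ 2 - ‖z‖ ^ 2) ^ a / ‖l - z‖ ^ 2)
        (Metric.closedBall 0 r) :=
      (continuousOn_mul_pow_div hc₁ hl hr a).integrableOn_compact (isCompact_closedBall 0 r)
    have hi₂ : IntegrableOn (fun z => F₂ z * (r ^ 2 - ‖z‖ ^ 2) ^ b / ‖l - z‖ ^ 2)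
        (Metric.closedBall 0 r) :=
      (continuousOn_mul_pow_div hc₂ hl hr b).integrableOn_compact (isCompact_closedBall 0 r)
    have hn₁ : 0 ≤ᵐ[volume.restrict (Metric.closedBall (0 : ℂ) r)]
        fun z => F₁ z * (r ^ 2 - ‖z‖ ^ 2) ^ a / ‖l - z‖ ^ 2 := by
      filter_upwards [ae_restrict_mem hmeas] with z hz
      have := hpos z hz
      have := h₁ z
      positivity
    have hn₂ : 0 ≤ᵐ[volume.restrict (Metric.closedBall (0 : ℂ) r)]
        fun z => F₂ z * (r ^ 2 - ‖z‖ ^ 2) ^ b / ‖l - z‖ ^ 2 := by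
      filter_upwards [ae_restrict_mem hmeas] with z hz
      have := hpos z hz
      have := h₂ z
      positivity
    calc ∫⁻ z in Metric.ball (0 : ℂ) 1, φ r z
        ≤ ∫⁻ z, φ r z := setLIntegral_le_lintegral _ _
      _ = ∫⁻ z in Metric.closedBall (0 : ℂ) r, φ r z := by
          refine (setLIntegral_eq_of_support_subset ?_).symm
          intro z hz
          by_contra hzr
          rw [mem_closedBall_zero_iff, not_le] at hzr
          have : max (r ^ 2 - ‖z‖ ^ 2) 0 = 0 := max_eq_right (by nlinarith)
          exact hz (by simp [hφ, this, show a ≠ 0 by omega])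
      _ = ∫⁻ z in Metric.closedBall (0 : ℂ) r,
            ENNReal.ofReal (F₁ z * (r ^ 2 - ‖z‖ ^ 2) ^ a / ‖l - z‖ ^ 2) := by
          refine setLIntegral_congr_fun hmeas fun z hz => ?_
          simp only [hφ, max_eq_left (hpos z hz)]
      _ = ENNReal.ofReal (∫ z in Metric.closedBall (0 : ℂ) r,
            F₁ z * (r ^ 2 - ‖z‖ ^ 2) ^ a / ‖l - z‖ ^ 2) :=
          (ofReal_integral_eq_lintegral_ofReal hi₁ hn₁).symm
      _ ≤ ENNReal.ofReal (C' + C * ∫ z in Metric.closedBall (0 : ℂ) r,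
            F₂ z * (r ^ 2 - ‖z‖ ^ 2) ^ b / ‖l - z‖ ^ 2) :=
          ENNReal.ofReal_le_ofReal (H r hr0 hr)
      _ = ENNReal.ofReal C' + ENNReal.ofReal C * ∫⁻ z in Metric.closedBall (0 : ℂ) r,
            ENNReal.ofReal (F₂ z * (r ^ 2 - ‖z‖ ^ 2) ^ b / ‖l - z‖ ^ 2) := by
          rw [ENNReal.ofReal_add hC' (mul_nonneg hC (integral_nonneg_of_ae hn₂)),
            ENNReal.ofReal_mul hC, ofReal_integral_eq_lintegral_ofReal hi₂ hn₂]
      _ ≤ B := by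
          refine add_le_add le_rfl (mul_le_mul' le_rfl ?_)
          refine (setLIntegral_mono' hmeas fun z hz => ?_).trans (lintegral_mono_set hsub)
          have := hpos z hz
          have := h₂ z
          refine ENNReal.ofReal_le_ofReal ?_
          gcongr
          nlinarith
  have hφm : ∀ r, Measurable (φ r) := fun r => by
    simp only [hφ]
    fun_prop
  have hlim : ∀ z ∈ Metric.ball (0 : ℂ) 1,
      ENNReal.ofReal (F₁ z * (1 - ‖z‖ ^ 2) ^ a / ‖l - z‖ ^ 2) =
        Filter.liminf (fun r => φ r z) (nhdsWithin 1 (Set.Iio 1)) := by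
    intro z hz
    have hz1 : ‖z‖ < 1 := mem_ball_zero_iff.1 hz
    refine (Filter.Tendsto.liminf_eq ?_).symm
    have hcont : Continuous fun r => φ r z := ENNReal.continuous_ofReal.comp (by fun_prop)
    have := (hcont.tendsto 1).mono_left (nhdsWithin_le_nhds (s := Set.Iio (1 : ℝ)))
    simpa [hφ, max_eq_left (show 0 ≤ 1 - ‖z‖ ^ 2 by nlinarith [norm_nonneg z])] using this
  rw [setLIntegral_congr_fun Metric.isOpen_ball.measurableSet hlim]
  refine (lintegral_liminf_le hφm).trans (Filter.liminf_le_of_frequently_le' ?_)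
  refine Filter.Eventually.frequently ?_
  filter_upwards [Ioo_mem_nhdsLT (zero_lt_one (α := ℝ))] with r hr
  exact hbound r hr.1 hr.2

theorem lintegral_poissonInt_eq {μ : Measure ℂ} [IsFiniteMeasure μ]
    (hμ : μ ((Metric.sphere (0 : ℂ) 1)ᶜ) = 0) {F : ℂ → ℝ} (hF : Measurable F)
    (hF0 : ∀ z, 0 ≤ F z) (k : ℕ) :
    ∫⁻ z in Metric.ball (0 : ℂ) 1, ENNReal.ofReal (F z * (1 - ‖z‖ ^ 2) ^ k * poissonInt μ z) =
      ENNReal.ofReal (2 * Real.pi)⁻¹ * ∫⁻ l, (∫⁻ z in Metric.ball (0 : ℂ) 1,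
        ENNReal.ofReal (F z * (1 - ‖z‖ ^ 2) ^ (k + 1) / ‖l - z‖ ^ 2)) ∂μ := by
  have hm : Measurable fun x : ℂ × ℂ =>
      ENNReal.ofReal (F x.2 * (1 - ‖x.2‖ ^ 2) ^ (k + 1) / ‖x.1 - x.2‖ ^ 2) := by fun_prop
  rw [lintegral_lintegral_swap hm.aemeasurable, ← lintegral_const_mul _ hm.lintegral_prod_left']
  have hsph : ∀ᵐ l ∂μ, ‖l‖ = 1 := by
    filter_upwards [compl_mem_ae_iff.2 hμ] with l hl
    simpa using hl
  refine setLIntegral_congr_fun Metric.isOpen_ball.measurableSet fun z hz => ?_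
  have hz1 : ‖z‖ < 1 := mem_ball_zero_iff.1 hz
  have hu : 0 ≤ 1 - ‖z‖ ^ 2 := by nlinarith [norm_nonneg z]
  have hint : Integrable (fun l => (1 - ‖z‖ ^ 2) / ‖l - z‖ ^ 2) μ := by
    refine Integrable.of_bound (C := (1 - ‖z‖ ^ 2) / (1 - ‖z‖) ^ 2)
      (Measurable.aestronglyMeasurable (by fun_prop)) ?_
    filter_upwards [hsph] with l hl
    have h1 : 1 - ‖z‖ ≤ ‖l - z‖ := by
      rw [← hl]
      exact norm_sub_norm_le l z
    have h2 : 0 < 1 - ‖z‖ := by linarith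
    rw [Real.norm_of_nonneg (by positivity)]
    gcongr
  have hk : 0 ≤ F z * (1 - ‖z‖ ^ 2) ^ k := mul_nonneg (hF0 z) (by positivity)
  simp only [poissonInt]
  rw [mul_left_comm, ENNReal.ofReal_mul (by positivity), ENNReal.ofReal_mul hk,
    ofReal_integral_eq_lintegral_ofReal hint (ae_of_all _ fun l => by positivity),
    ← lintegral_const_mul _ (by fun_prop)]
  congr 2
  funext l
  rw [← ENNReal.ofReal_mul hk]
  congr 1
  ring

theorem integral_closedBall_re_deriv_mul_conj_mul_pow {p q : ℂ → ℂ}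
    (hp : DifferentiableOn ℂ p (Metric.ball 0 1)) (hq : DifferentiableOn ℂ q (Metric.ball 0 1))
    {r : ℝ} (hr0 : 0 < r) (hr : r < 1) {j : ℕ} (hj : 1 ≤ j) :
    IntegrableOn (fun z => (deriv p z * conj (q z) * ((r ^ 2 - ‖z‖ ^ 2 : ℝ) : ℂ) ^ (j + 1)
        - (j + 1) * conj z * p z * conj (q z) * ((r ^ 2 - ‖z‖ ^ 2 : ℝ) : ℂ) ^ j).re)
        (Metric.closedBall (0 : ℂ) r) ∧
      ∫ z in Metric.closedBall (0 : ℂ) r,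
        (deriv p z * conj (q z) * ((r ^ 2 - ‖z‖ ^ 2 : ℝ) : ℂ) ^ (j + 1)
          - (j + 1) * conj z * p z * conj (q z) * ((r ^ 2 - ‖z‖ ^ 2 : ℝ) : ℂ) ^ j).re = 0 := by
  have hsub : Metric.closedBall (0 : ℂ) r ⊆ Metric.ball 0 1 := Metric.closedBall_subset_ball hr
  have hpc := hp.continuousOn.mono hsub
  have hqc := hq.continuousOn.mono hsub
  have hpc' := (hp.deriv Metric.isOpen_ball).continuousOn.mono hsub
  have hi : IntegrableOn (fun z => deriv p z * conj (q z) * ((r ^ 2 - ‖z‖ ^ 2 : ℝ) : ℂ) ^ (j + 1)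
      - (j + 1) * conj z * p z * conj (q z) * ((r ^ 2 - ‖z‖ ^ 2 : ℝ) : ℂ) ^ j)
      (Metric.closedBall (0 : ℂ) r) := by
    refine ContinuousOn.integrableOn_compact (isCompact_closedBall 0 r) ?_
    fun_prop
  refine ⟨hi.re, ?_⟩
  have := Complex.reCLM.integral_comp_comm hi
  rw [integral_closedBall_deriv_mul_conj_mul_pow hp hq hr0 hr hj] at this
  simpa using this

theorem one_sub_conj_mul_ne_zero {l z : ℂ} (hl : ‖l‖ = 1) (hz : ‖z‖ < 1) :
    1 - conj l * z ≠ 0 := by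
  rw [← norm_ne_zero_iff, norm_one_sub_conj_mul hl, norm_ne_zero_iff]
  exact sub_ne_zero_of_norm_lt hl hz

theorem hasDerivAt_one_sub_mul (m z : ℂ) : HasDerivAt (fun z => 1 - m * z) (-m) z := by
  simpa using ((hasDerivAt_id z).const_mul m).const_sub 1

theorem setIntegral_norm_sq_deriv_le {g : ℂ → ℂ} (hg : DifferentiableOn ℂ g (Metric.ball 0 1))
    {l : ℂ} (hl : ‖l‖ = 1) {r : ℝ} (hr0 : 0 < r) (hr : r < 1) (e : ℕ) :
    ∫ z in Metric.closedBall (0 : ℂ) r,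
        ‖deriv g z‖ ^ 2 * (r ^ 2 - ‖z‖ ^ 2) ^ (e + 2) / ‖l - z‖ ^ 2 ≤
      (e + 4) ^ 2 * ∫ z in Metric.closedBall (0 : ℂ) r,
        ‖g z‖ ^ 2 * (r ^ 2 - ‖z‖ ^ 2) ^ e / ‖l - z‖ ^ 2 := by
  have hζ : ∀ z ∈ Metric.ball (0 : ℂ) 1, 1 - conj l * z ≠ 0 := fun z hz =>
    one_sub_conj_mul_ne_zero hl (mem_ball_zero_iff.1 hz)
  have hg' := hg.deriv Metric.isOpen_ball
  have hd : DifferentiableOn ℂ (fun z : ℂ => 1 - conj l * z) (Metric.ball 0 1) := by fun_prop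
  obtain ⟨hE, hE0⟩ := integral_closedBall_re_deriv_mul_conj_mul_pow (hg.fun_div hd hζ)
    (hg'.fun_div hd hζ) hr0 hr (Nat.le_add_left 1 e)
  have hi₁ := (continuousOn_mul_pow_div (F := fun z => ‖deriv g z‖ ^ 2)
    (hg'.continuousOn.norm.pow 2) hl hr (e + 2)).integrableOn_compact
    (isCompact_closedBall 0 r) (μ := volume)
  have hi₂ := (continuousOn_mul_pow_div (F := fun z => ‖g z‖ ^ 2)
    (hg.continuousOn.norm.pow 2) hl hr e).integrableOn_compact
    (isCompact_closedBall 0 r) (μ := volume)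
  have hmono := setIntegral_mono_on hi₁ ((hi₂.const_mul (((e : ℝ) + 4) ^ 2)).add (hE.const_mul 2))
    Metric.isClosed_closedBall.measurableSet fun z hz => by
      have hz' := mem_closedBall_zero_iff.1 hz
      have hzb : z ∈ Metric.ball (0 : ℂ) 1 := Metric.closedBall_subset_ball hr hz
      have hgd := (hg.differentiableAt (Metric.isOpen_ball.mem_nhds hzb)).hasDerivAt
      have hdp : deriv (fun z => g z / (1 - conj l * z)) z =
          deriv g z / (1 - conj l * z) + g z * conj l / (1 - conj l * z) ^ 2 := by
        have := hζ z hzb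
        rw [(hgd.fun_div (hasDerivAt_one_sub_mul (conj l) z) this).deriv]
        field_simp
        ring
      have := norm_sq_deriv_le_add_re (G := g z) (G' := deriv g z) (u := r ^ 2 - ‖z‖ ^ 2) e hl
        (mem_ball_zero_iff.1 hzb) (by nlinarith [norm_nonneg z]) (by nlinarith)
      rw [← hdp] at this
      exact this
  have hadd := integral_add (hi₂.const_mul (((e : ℝ) + 4) ^ 2)) (hE.const_mul 2)
  rw [integral_const_mul, integral_const_mul, hE0, mul_zero, add_zero] at hadd
  exact hmono.trans hadd.le

theorem setIntegral_norm_sq_le {g : ℂ → ℂ} (hg : DifferentiableOn ℂ g (Metric.ball 0 1)) {e : ℕ}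
    (he : 1 ≤ e) :
    ∃ C' : ℝ, 0 ≤ C' ∧ ∀ l : ℂ, ‖l‖ = 1 → ∀ r : ℝ, 0 < r → r < 1 →
      ∫ z in Metric.closedBall (0 : ℂ) r, ‖g z‖ ^ 2 * (r ^ 2 - ‖z‖ ^ 2) ^ e / ‖l - z‖ ^ 2 ≤
        C' + 56 * ∫ z in Metric.closedBall (0 : ℂ) r,
          ‖deriv g z‖ ^ 2 * (r ^ 2 - ‖z‖ ^ 2) ^ (e + 2) / ‖l - z‖ ^ 2 := by
  obtain ⟨M, hM⟩ := (isCompact_closedBall (0 : ℂ) (19 / 20)).exists_bound_of_continuousOn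
    (hg.continuousOn.mono (Metric.closedBall_subset_ball (by norm_num)))
  refine ⟨volume.real (Metric.ball (0 : ℂ) 1) * (12800 * M ^ 2), by positivity,
    fun l hl r hr0 hr => ?_⟩
  have hζ : ∀ z ∈ Metric.ball (0 : ℂ) 1, 1 - conj l * z ≠ 0 := fun z hz =>
    one_sub_conj_mul_ne_zero hl (mem_ball_zero_iff.1 hz)
  have hζ2 : ∀ z ∈ Metric.ball (0 : ℂ) 1, (1 - conj l * z) ^ 2 ≠ 0 := fun z hz =>
    pow_ne_zero 2 (hζ z hz)
  have hg' := hg.deriv Metric.isOpen_ball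
  have hd : DifferentiableOn ℂ (fun z : ℂ => 1 - conj l * z) (Metric.ball 0 1) := by fun_prop
  have hzg : DifferentiableOn ℂ (fun z : ℂ => z * g z) (Metric.ball 0 1) :=
    differentiableOn_id.fun_mul hg
  obtain ⟨hE, hE0⟩ := integral_closedBall_re_deriv_mul_conj_mul_pow (hzg.fun_div hd hζ)
    (hg.fun_div hd hζ) hr0 hr he
  obtain ⟨hF, hF0⟩ := integral_closedBall_re_deriv_mul_conj_mul_pow hzg
    (hg.fun_div (hd.fun_pow 2) hζ2) hr0 hr he
  have hi₁ := (continuousOn_mul_pow_div (F := fun z => ‖deriv g z‖ ^ 2)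
    (hg'.continuousOn.norm.pow 2) hl hr (e + 2)).integrableOn_compact
    (isCompact_closedBall 0 r) (μ := volume)
  have hi₂ := (continuousOn_mul_pow_div (F := fun z => ‖g z‖ ^ 2)
    (hg.continuousOn.norm.pow 2) hl hr e).integrableOn_compact
    (isCompact_closedBall 0 r) (μ := volume)
  have hc : IntegrableOn (fun _ : ℂ => 12800 * M ^ 2) (Metric.closedBall (0 : ℂ) r) :=
    integrableOn_const measure_closedBall_lt_top.ne
  have hmono := setIntegral_mono_on hi₂
    ((hc.add (hi₁.const_mul 56)).add ((hE.const_mul (-8)).add (hF.const_mul (-6))))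
    Metric.isClosed_closedBall.measurableSet fun z hz => by
      have hz' := mem_closedBall_zero_iff.1 hz
      have hzb : z ∈ Metric.ball (0 : ℂ) 1 := Metric.closedBall_subset_ball hr hz
      have hgd := (hg.differentiableAt (Metric.isOpen_ball.mem_nhds hzb)).hasDerivAt
      have hzgd := (hasDerivAt_id' z).fun_mul hgd
      have hdp : deriv (fun z => z * g z / (1 - conj l * z)) z =
          g z / (1 - conj l * z) ^ 2 + z * deriv g z / (1 - conj l * z) := by
        have := hζ z hzb
        rw [(hzgd.fun_div (hasDerivAt_one_sub_mul (conj l) z) this).deriv]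
        field_simp
        ring
      have hdq : deriv (fun z => z * g z) z = g z + z * deriv g z := by
        rw [hzgd.deriv, one_mul]
      have := norm_sq_le_sub_re (G := g z) (G' := deriv g z) (u := r ^ 2 - ‖z‖ ^ 2) (M := M) he hl
        (mem_ball_zero_iff.1 hzb) (by nlinarith [norm_nonneg z]) (by nlinarith)
        (fun h => hM z (mem_closedBall_zero_iff.2 h))
      rw [← hdp, ← hdq, Complex.add_re, show (3 / 4 : ℂ) = ((3 / 4 : ℝ) : ℂ) by push_cast; rfl,
        Complex.re_ofReal_mul] at this
      simp only [Pi.add_apply]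
      linarith
  have hadd := integral_add (hc.add (hi₁.const_mul 56))
    ((hE.const_mul (-8)).add (hF.const_mul (-6)))
  have hadd₁ := integral_add hc (hi₁.const_mul 56)
  have hadd₂ := integral_add (hE.const_mul (-8)) (hF.const_mul (-6))
  rw [integral_const_mul, integral_const_mul, hE0, hF0, mul_zero, mul_zero, add_zero] at hadd₂
  rw [setIntegral_const, smul_eq_mul, integral_const_mul] at hadd₁
  have hvol : volume.real (Metric.closedBall (0 : ℂ) r) * (12800 * M ^ 2) ≤
      volume.real (Metric.ball (0 : ℂ) 1) * (12800 * M ^ 2) :=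
    mul_le_mul_of_nonneg_right (measureReal_mono (Metric.closedBall_subset_ball hr)
      measure_ball_lt_top.ne) (by positivity)
  refine hmono.trans (hadd.le.trans ?_)
  refine (add_le_add hadd₁.le hadd₂.le).trans ?_
  rw [add_zero]
  exact add_le_add hvol le_rfl

theorem lintegral_poissonInt_lt_top_of_le {μ : Measure ℂ} [IsFiniteMeasure μ]
    (hμ : μ ((Metric.sphere (0 : ℂ) 1)ᶜ) = 0) {F₁ F₂ : ℂ → ℝ} (hF₁ : Measurable F₁)
    (hF₂ : Measurable F₂)
    (hc₁ : ContinuousOn F₁ (Metric.ball 0 1)) (hc₂ : ContinuousOn F₂ (Metric.ball 0 1))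
    (h₁ : ∀ z, 0 ≤ F₁ z) (h₂ : ∀ z, 0 ≤ F₂ z) {a b : ℕ} {C C' : ℝ} (hC : 0 ≤ C) (hC' : 0 ≤ C')
    (H : ∀ l : ℂ, ‖l‖ = 1 → ∀ r : ℝ, 0 < r → r < 1 →
      ∫ z in Metric.closedBall (0 : ℂ) r, F₁ z * (r ^ 2 - ‖z‖ ^ 2) ^ (a + 1) / ‖l - z‖ ^ 2 ≤
        C' + C * ∫ z in Metric.closedBall (0 : ℂ) r,
          F₂ z * (r ^ 2 - ‖z‖ ^ 2) ^ (b + 1) / ‖l - z‖ ^ 2)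
    (hfin : ∫⁻ z in Metric.ball (0 : ℂ) 1,
      ENNReal.ofReal (F₂ z * (1 - ‖z‖ ^ 2) ^ b * poissonInt μ z) < ⊤) :
    ∫⁻ z in Metric.ball (0 : ℂ) 1,
      ENNReal.ofReal (F₁ z * (1 - ‖z‖ ^ 2) ^ a * poissonInt μ z) < ⊤ := by
  have hpi : ENNReal.ofReal (2 * Real.pi)⁻¹ ≠ 0 := by
    rw [Ne, ENNReal.ofReal_eq_zero, not_le]
    positivity
  rw [lintegral_poissonInt_eq hμ hF₂ h₂] at hfin
  rw [lintegral_poissonInt_eq hμ hF₁ h₁]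
  refine ENNReal.mul_lt_top ENNReal.ofReal_lt_top ?_
  have hfin' := ENNReal.lt_top_of_mul_ne_top_right hfin.ne hpi
  have hsph : ∀ᵐ l ∂μ, ‖l‖ = 1 := by
    filter_upwards [compl_mem_ae_iff.2 hμ] with l hl
    simpa using hl
  refine (lintegral_mono_ae (hsph.mono fun l hl =>
    lintegral_ball_le_of_integral_closedBall_le hF₁ hc₁ hc₂ h₁ h₂ hl (by omega) hC hC'
      (H l hl))).trans_lt ?_
  rw [lintegral_add_left measurable_const, lintegral_const_mul' _ _ ENNReal.ofReal_ne_top,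
    lintegral_const]
  exact ENNReal.add_lt_top.2 ⟨ENNReal.mul_lt_top ENNReal.ofReal_lt_top (measure_lt_top μ _),
    ENNReal.mul_lt_top ENNReal.ofReal_lt_top hfin'⟩

theorem differentiableOn_iteratedDeriv {f : ℂ → ℂ} {s : Set ℂ} (hf : DifferentiableOn ℂ f s)
    (hs : IsOpen s) (n : ℕ) : DifferentiableOn ℂ (iteratedDeriv n f) s := by
  induction n with
  | zero => simpa using hf
  | succ n ih =>
    rw [iteratedDeriv_succ]
    exact ih.deriv hs

theorem lintegral_deriv_poissonInt_lt_top_iff {μ : Measure ℂ} [IsFiniteMeasure μ]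
    (hμ : μ ((Metric.sphere (0 : ℂ) 1)ᶜ) = 0) {g : ℂ → ℂ} (hgm : Measurable g)
    (hg : DifferentiableOn ℂ g (Metric.ball 0 1)) (k : ℕ) :
    ∫⁻ z in Metric.ball (0 : ℂ) 1,
        ENNReal.ofReal (‖g z‖ ^ 2 * (1 - ‖z‖ ^ 2) ^ k * poissonInt μ z) < ⊤ ↔
      ∫⁻ z in Metric.ball (0 : ℂ) 1,
        ENNReal.ofReal (‖deriv g z‖ ^ 2 * (1 - ‖z‖ ^ 2) ^ (k + 2) * poissonInt μ z) < ⊤ := by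
  have hm₀ : Measurable fun z => ‖g z‖ ^ 2 := hgm.norm.pow_const 2
  have hm₁ : Measurable fun z => ‖deriv g z‖ ^ 2 := (measurable_deriv g).norm.pow_const 2
  have hc₀ : ContinuousOn (fun z => ‖g z‖ ^ 2) (Metric.ball 0 1) := hg.continuousOn.norm.pow 2
  have hc₁ : ContinuousOn (fun z => ‖deriv g z‖ ^ 2) (Metric.ball 0 1) :=
    (hg.deriv Metric.isOpen_ball).continuousOn.norm.pow 2
  constructor
  · refine lintegral_poissonInt_lt_top_of_le hμ hm₁ hm₀ hc₁ hc₀ (fun z => by positivity)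
      (fun z => by positivity) (C := ((k + 1 : ℕ) + 4) ^ 2) (by positivity) le_rfl
      fun l hl r hr0 hr => ?_
    rw [zero_add]
    exact setIntegral_norm_sq_deriv_le hg hl hr0 hr (k + 1)
  · obtain ⟨C', hC', h⟩ := setIntegral_norm_sq_le hg (Nat.le_add_left 1 k)
    exact lintegral_poissonInt_lt_top_of_le hμ hm₀ hm₁ hc₀ hc₁ (fun z => by positivity)
      (fun z => by positivity) (by norm_num) hC' h

theorem stmt10 (μ : Measure ℂ) [IsFiniteMeasure μ] (hμ : μ ((Metric.sphere (0:ℂ) 1)ᶜ) = 0)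
    (n : ℕ) (f : ℂ → ℂ) (hf : DifferentiableOn ℂ f (Metric.ball (0:ℂ) 1)) :
    (∫⁻ z in Metric.ball (0:ℂ) 1,
        ENNReal.ofReal (‖deriv f z‖ ^ 2 * poissonInt μ z)) < ⊤ ↔
    (∫⁻ z in Metric.ball (0:ℂ) 1,
        ENNReal.ofReal (‖iteratedDeriv (n + 1) f z‖ ^ 2 * (1 - ‖z‖ ^ 2) ^ (2 * n)
          * poissonInt μ z)) < ⊤ := by
  induction n with
  | zero => simp
  | succ n ih =>
    rw [ih, lintegral_deriv_poissonInt_lt_top_iff hμ ?_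
      (differentiableOn_iteratedDeriv hf Metric.isOpen_ball (n + 1)) (2 * n),
      ← iteratedDeriv_succ, mul_add, mul_one]
    rw [iteratedDeriv_succ]
    exact measurable_deriv _
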